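/- Loss bound for the VAW meta-algorithm applied to truncated expert predictions: let λ > 0, Y > 0, let z_1,…,z_T ∈ ℝ^N be arbitrary (expert predictions), let y_1,…,y_T ∈ ℝ with |y_t| ≤ Y, and set z̄_{t,j} = min(Y, max(z_{t,j}, −Y)). Let α_t ∈ ℝ^N be the VAW iterates with parameter λ applied to (z̄_t, y_t)_{t=1}^T. Then for every j ∈ {1,…,N}, (1/2) Σ_{t=1}^T (⟨α_t, z̄_t⟩ − y_t)² ≤ (1/2) Σ_{t=1}^T (z_{t,j} − y_t)² + λ/2 + (N Y²/2) ln(1 + Y² T/λ). -/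

import Mathlib

open MeasureTheory

/-- The Vovk–Azoury–Warmuth (VAW) iterates with regularization parameter `lam`,
applied to input vectors `u 1, u 2, …` (indexed by a finite type `ι`) and labels
`y 1, y 2, …`:  `w t = S t ⁻¹ (∑_{i=1}^{t-1} y i • u i)`, where
`S t = lam • I + ∑_{i=1}^{t} (u i) (u i)ᵀ` (positive definite, hence the matrix
inverse is the true inverse). -/
noncomputable def vaw {ι : Type*} [Fintype ι] [DecidableEq ι] (lam : ℝ)
    (u : ℕ → ι → ℝ) (y : ℕ → ℝ) (t : ℕ) : ι → ℝ :=
  ((lam • (1 : Matrix ι ι ℝ) + ∑ i ∈ Finset.Icc 1 t, Matrix.vecMulVec (u i) (u i))⁻¹).mulVec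
    (∑ i ∈ Finset.Icc 1 (t - 1), y i • u i)

open Matrix in
/-- The matrix determinant lemma for a symmetric rank-one update. -/
theorem Matrix.PosDef.det_add_vecMulVec_self {ι : Type*} [Fintype ι] [DecidableEq ι]
    {A : Matrix ι ι ℝ} (hA : A.PosDef) (u : ι → ℝ) :
    (A + vecMulVec u u).det = A.det * (1 + u ⬝ᵥ A⁻¹ *ᵥ u) := by
  rw [vecMulVec_eq Unit, det_add_replicateCol_mul_replicateRow hA.det_pos.ne'.isUnit,
    Matrix.mul_assoc, ← replicateCol_mulVec, det_unique (n := Unit), Matrix.add_apply, one_apply_eq,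
    replicateRow_mul_replicateCol_apply]

open Matrix in
/-- A real positive definite matrix has a symmetric inverse. -/
theorem Matrix.PosDef.dotProduct_inv_mulVec_comm {ι : Type*} [Fintype ι] [DecidableEq ι]
    {A : Matrix ι ι ℝ} (hA : A.PosDef) (v w : ι → ℝ) :
    v ⬝ᵥ A⁻¹ *ᵥ w = w ⬝ᵥ A⁻¹ *ᵥ v := by
  have h : A⁻¹ᵀ = A⁻¹ := by simpa using hA.inv.isHermitian.eq
  rw [dotProduct_mulVec, ← mulVec_transpose, h, dotProduct_comm]

open Matrix in
/-- Completing the square: `v ↦ ⟨v, A v⟩ / 2 - ⟨v, b⟩` is at least `-⟨b, A⁻¹ b⟩ / 2`. -/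
theorem Matrix.PosDef.two_mul_dotProduct_le {ι : Type*} [Fintype ι] [DecidableEq ι]
    {A : Matrix ι ι ℝ} (hA : A.PosDef) (v b : ι → ℝ) :
    2 * (v ⬝ᵥ b) ≤ v ⬝ᵥ A *ᵥ v + b ⬝ᵥ A⁻¹ *ᵥ b := by
  have hdet : IsUnit A.det := hA.det_pos.ne'.isUnit
  have h := hA.inv.posSemidef.dotProduct_mulVec_nonneg (A *ᵥ v - b)
  have hv : A⁻¹ *ᵥ A *ᵥ v = v := by rw [mulVec_mulVec, nonsing_inv_mul _ hdet, one_mulVec]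
  have hc := hA.dotProduct_inv_mulVec_comm (A *ᵥ v) b
  rw [hv] at hc
  simp only [star_trivial, mulVec_sub, hv, sub_dotProduct, dotProduct_sub, hc] at h
  rw [dotProduct_comm (A *ᵥ v) v, dotProduct_comm b v] at h
  linarith

/-- The determinant of a real positive definite matrix whose trace is at most `n * c` is at most
`c ^ n`, in logarithmic form. -/
theorem Matrix.PosDef.log_det_le {ι : Type*} [Fintype ι] [DecidableEq ι]
    {A : Matrix ι ι ℝ} (hA : A.PosDef) {c : ℝ} (hc : 0 < c)
    (htr : A.trace ≤ Fintype.card ι * c) :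
    Real.log A.det ≤ Fintype.card ι * Real.log c := by
  have hpos := hA.eigenvalues_pos
  have hdet : A.det = ∏ i, hA.1.eigenvalues i := by
    simpa using hA.1.det_eq_prod_eigenvalues
  have htrace : A.trace = ∑ i, hA.1.eigenvalues i := by
    simpa using hA.1.trace_eq_sum_eigenvalues
  rw [hdet, Real.log_prod fun i _ ↦ (hpos i).ne']
  calc ∑ i, Real.log (hA.1.eigenvalues i)
      ≤ ∑ i, (hA.1.eigenvalues i / c - 1 + Real.log c) := by
        refine Finset.sum_le_sum fun i _ ↦ ?_
        have h := Real.log_le_sub_one_of_pos (div_pos (hpos i) hc)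
        rw [Real.log_div (hpos i).ne' hc.ne'] at h
        linarith
    _ = A.trace / c - Fintype.card ι + Fintype.card ι * Real.log c := by
        simp [Finset.sum_add_distrib, Finset.sum_sub_distrib, Finset.sum_div, htrace]
    _ ≤ Fintype.card ι * Real.log c := by
        have := (div_le_iff₀ hc).2 htr
        linarith

open Matrix in
/-- One round of the VAW analysis: the loss is bounded by the increase of the regularized
least-squares optimum plus the increase of the log-determinant. -/
theorem vaw_step {ι : Type*} [Fintype ι] [DecidableEq ι] {A : Matrix ι ι ℝ} (hA : A.PosDef)
    (u b : ι → ℝ) {η Y : ℝ} (hη : |η| ≤ Y) :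
    (((A + vecMulVec u u)⁻¹ *ᵥ b) ⬝ᵥ u - η) ^ 2 ≤
      η ^ 2 - (b + η • u) ⬝ᵥ (A + vecMulVec u u)⁻¹ *ᵥ (b + η • u) + b ⬝ᵥ A⁻¹ *ᵥ b
        + Y ^ 2 * (Real.log (A + vecMulVec u u).det - Real.log A.det) := by
  have hB : (A + vecMulVec u u).PosDef := by
    simpa using hA.add_posSemidef (posSemidef_vecMulVec_self_star u)
  have hdet := hA.det_add_vecMulVec_self u
  have hAu : IsUnit A.det := hA.det_pos.ne'.isUnit
  have hBu := hB.det_pos.ne'.isUnit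
  have hq₀ : 0 ≤ u ⬝ᵥ A⁻¹ *ᵥ u := by
    simpa using hA.inv.posSemidef.dotProduct_mulVec_nonneg u
  have hlog : Real.log (A + vecMulVec u u).det - Real.log A.det
      = Real.log (1 + u ⬝ᵥ A⁻¹ *ᵥ u) := by
    rw [hdet, Real.log_mul hA.det_pos.ne' (by positivity)]
    ring
  have key (c : ι → ℝ) : A⁻¹ *ᵥ c = (A + vecMulVec u u)⁻¹ *ᵥ c
      + (u ⬝ᵥ (A + vecMulVec u u)⁻¹ *ᵥ c) • A⁻¹ *ᵥ u := by
    have h : (A + vecMulVec u u) *ᵥ (A + vecMulVec u u)⁻¹ *ᵥ c = c := by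
      rw [mulVec_mulVec, mul_nonsing_inv _ hBu, one_mulVec]
    rw [add_mulVec, vecMulVec_mulVec] at h
    have h' := congrArg (A⁻¹ *ᵥ ·) h
    simp only [mulVec_add, mulVec_mulVec, nonsing_inv_mul_cancel_left A _ hAu, op_smul_eq_smul,
      mulVec_smul] at h'
    exact h'.symm
  have hb := congrArg (b ⬝ᵥ ·) (key b)
  have hub := congrArg (u ⬝ᵥ ·) (key b)
  have huu := congrArg (u ⬝ᵥ ·) (key u)
  simp only [dotProduct_add, dotProduct_smul, smul_eq_mul] at hb hub huu
  rw [hA.dotProduct_inv_mulVec_comm b u, hub] at hb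
  have hsymm := hB.dotProduct_inv_mulVec_comm b u
  rw [hlog, hb, dotProduct_comm _ u]
  simp only [mulVec_add, mulVec_smul, dotProduct_add, add_dotProduct, dotProduct_smul,
    smul_dotProduct, smul_eq_mul, hsymm]
  generalize u ⬝ᵥ A⁻¹ *ᵥ u = q₀ at *
  generalize u ⬝ᵥ (A + vecMulVec u u)⁻¹ *ᵥ u = q at *
  generalize u ⬝ᵥ (A + vecMulVec u u)⁻¹ *ᵥ b = p at *
  have hpos : 0 < 1 + q₀ := by positivity
  have hq : q ≤ Real.log (1 + q₀) := by
    have h := Real.one_sub_inv_le_log_of_pos hpos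
    have : 1 - (1 + q₀)⁻¹ = q := by
      field_simp
      linarith
    linarith
  have hL : 0 ≤ Real.log (1 + q₀) := Real.log_nonneg (by linarith)
  have hη2 : η ^ 2 ≤ Y ^ 2 := sq_le_sq' (abs_le.1 hη).1 (abs_le.1 hη).2
  have h₁ := mul_le_mul_of_nonneg_left hq (sq_nonneg η)
  have h₂ := mul_le_mul_of_nonneg_right hη2 hL
  have h₃ := mul_nonneg (sq_nonneg p) hq₀
  linarith

open Matrix in
theorem vaw_matrix_posDef {ι : Type*} [Fintype ι] [DecidableEq ι] {lam : ℝ} (hlam : 0 < lam)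
    (u : ℕ → ι → ℝ) (t : ℕ) :
    (lam • (1 : Matrix ι ι ℝ) + ∑ i ∈ Finset.Icc 1 t, vecMulVec (u i) (u i)).PosDef :=
  (PosDef.one.smul hlam).add_posSemidef <| posSemidef_sum _ fun i _ ↦ by
    simpa using posSemidef_vecMulVec_self_star (u i)

open Matrix in
/-- The cumulative VAW loss is bounded by the regularized least-squares optimum plus a
log-determinant term. -/
theorem vaw_sum_loss_le {ι : Type*} [Fintype ι] [DecidableEq ι] {lam Y : ℝ} (hlam : 0 < lam)
    (u : ℕ → ι → ℝ) (y : ℕ → ℝ) (T : ℕ) (hy : ∀ t ∈ Finset.Icc 1 T, |y t| ≤ Y) :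
    ∑ t ∈ Finset.Icc 1 T, (vaw lam u y t ⬝ᵥ u t - y t) ^ 2 ≤
      ∑ t ∈ Finset.Icc 1 T, y t ^ 2
        - (∑ t ∈ Finset.Icc 1 T, y t • u t) ⬝ᵥ
          (lam • (1 : Matrix ι ι ℝ) + ∑ t ∈ Finset.Icc 1 T, vecMulVec (u t) (u t))⁻¹ *ᵥ
            (∑ t ∈ Finset.Icc 1 T, y t • u t)
        + Y ^ 2 * (Real.log
            (lam • (1 : Matrix ι ι ℝ) + ∑ t ∈ Finset.Icc 1 T, vecMulVec (u t) (u t)).det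
          - Fintype.card ι * Real.log lam) := by
  induction T with
  | zero => simp
  | succ T ih =>
    have ih := ih fun t ht ↦ hy t (Finset.Icc_subset_Icc_right T.le_succ ht)
    have step := vaw_step (vaw_matrix_posDef hlam u T) (u (T + 1))
      (∑ t ∈ Finset.Icc 1 T, y t • u t) (hy (T + 1) (by simp))
    simp only [Finset.sum_Icc_succ_top (Nat.le_add_left 1 T), ← add_assoc]
    rw [vaw, Nat.add_sub_cancel, Finset.sum_Icc_succ_top (Nat.le_add_left 1 T), ← add_assoc]
    linarith

open Matrix in
/-- Regret bound of the VAW algorithm against an arbitrary comparator `w`, for inputs with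
coordinates bounded by `X`. -/
theorem vaw_regret_bound {ι : Type*} [Fintype ι] [DecidableEq ι] {lam X Y : ℝ} (hlam : 0 < lam)
    (u : ℕ → ι → ℝ) (y : ℕ → ℝ) (T : ℕ) (hy : ∀ t ∈ Finset.Icc 1 T, |y t| ≤ Y)
    (hu : ∀ t ∈ Finset.Icc 1 T, ∀ i, |u t i| ≤ X) (w : ι → ℝ) :
    ∑ t ∈ Finset.Icc 1 T, (vaw lam u y t ⬝ᵥ u t - y t) ^ 2 ≤
      ∑ t ∈ Finset.Icc 1 T, (w ⬝ᵥ u t - y t) ^ 2 + lam * (w ⬝ᵥ w)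
        + Fintype.card ι * Y ^ 2 * Real.log (1 + X ^ 2 * T / lam) := by
  have hS := vaw_matrix_posDef hlam u T
  have hloss := vaw_sum_loss_le hlam u y T hy
  have hcomp := hS.two_mul_dotProduct_le w (∑ t ∈ Finset.Icc 1 T, y t • u t)
  have hc : 0 < lam + X ^ 2 * T := by positivity
  have hdet := hS.log_det_le hc (by
    have hsq : ∑ t ∈ Finset.Icc 1 T, u t ⬝ᵥ u t
        ≤ ∑ t ∈ Finset.Icc 1 T, Fintype.card ι * X ^ 2 := by
      refine Finset.sum_le_sum fun t ht ↦ ?_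
      calc u t ⬝ᵥ u t ≤ ∑ _i : ι, X ^ 2 := Finset.sum_le_sum fun i _ ↦ by
            have h := abs_le.1 (hu t ht i)
            nlinarith
        _ = Fintype.card ι * X ^ 2 := by simp
    simp only [Finset.sum_const, Nat.card_Icc, Nat.add_sub_cancel, nsmul_eq_mul] at hsq
    simp only [trace_add, trace_smul, trace_one, trace_sum, trace_vecMulVec, smul_eq_mul]
    linarith)
  have hlog : Real.log (1 + X ^ 2 * T / lam) = Real.log (lam + X ^ 2 * T) - Real.log lam := by
    rw [← Real.log_div hc.ne' hlam.ne', add_div, div_self hlam.ne']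
  have hquad : w ⬝ᵥ (lam • (1 : Matrix ι ι ℝ)
      + ∑ t ∈ Finset.Icc 1 T, vecMulVec (u t) (u t)) *ᵥ w
      = lam * (w ⬝ᵥ w) + ∑ t ∈ Finset.Icc 1 T, (w ⬝ᵥ u t) ^ 2 := by
    simp only [add_mulVec, smul_mulVec, one_mulVec, sum_mulVec, vecMulVec_mulVec,
      dotProduct_add, dotProduct_sum, dotProduct_smul, op_smul_eq_smul, smul_eq_mul]
    congr 1
    exact Finset.sum_congr rfl fun t _ ↦ by rw [dotProduct_comm (u t) w, sq]
  have hexp : ∑ t ∈ Finset.Icc 1 T, (w ⬝ᵥ u t - y t) ^ 2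
      = ∑ t ∈ Finset.Icc 1 T, (w ⬝ᵥ u t) ^ 2
        - 2 * (w ⬝ᵥ ∑ t ∈ Finset.Icc 1 T, y t • u t) + ∑ t ∈ Finset.Icc 1 T, y t ^ 2 := by
    simp only [dotProduct_sum, dotProduct_smul, smul_eq_mul, Finset.mul_sum,
      ← Finset.sum_sub_distrib, ← Finset.sum_add_distrib]
    exact Finset.sum_congr rfl fun t _ ↦ by ring
  have hmul := mul_le_mul_of_nonneg_left hdet (sq_nonneg Y)
  rw [hquad] at hcomp
  rw [hexp, hlog]
  linarith

/-- Clipping a prediction to `[-Y, Y]` does not increase its squared loss on labels in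
`[-Y, Y]`. -/
theorem sq_clip_sub_le {Y z y : ℝ} (hy : |y| ≤ Y) :
    (min Y (max z (-Y)) - y) ^ 2 ≤ (z - y) ^ 2 := by
  obtain ⟨h₁, h₂⟩ := abs_le.1 hy
  rcases le_total z (-Y) with h | h
  · rw [max_eq_right h, min_eq_right (by linarith)]
    nlinarith
  · rw [max_eq_left h]
    rcases le_total Y z with h' | h'
    · rw [min_eq_left h']
      nlinarith
    · rw [min_eq_right h']

/-- **Loss bound for the VAW meta-algorithm applied to truncated expert predictions.**
Let `λ > 0`, `Y > 0`, `z_1,…,z_T ∈ ℝ^N` arbitrary expert predictions, `|y_t| ≤ Y`,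
and `z̄_{t,j} = min(Y, max(z_{t,j}, −Y))`.  If `α_t` are the VAW iterates with
parameter `λ` on `(z̄_t, y_t)ₜ`, then for every `j`:
`(1/2) ∑ₜ (⟨α_t, z̄_t⟩ − y_t)² ≤ (1/2) ∑ₜ (z_{t,j} − y_t)² + λ/2 + (N Y²/2) ln(1 + Y² T/λ)`. -/
theorem vaw_meta_truncated_loss_bound
    (N T : ℕ) (lam Y : ℝ) (hlam : 0 < lam) (hY : 0 < Y)
    (z : ℕ → Fin N → ℝ) (y : ℕ → ℝ) (hy : ∀ t ∈ Finset.Icc 1 T, |y t| ≤ Y)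
    (zbar : ℕ → Fin N → ℝ)
    (hzbar : ∀ t i, zbar t i = min Y (max (z t i) (-Y))) :
    ∀ j : Fin N,
      (1 / 2) * ∑ t ∈ Finset.Icc 1 T, ((∑ i, vaw lam zbar y t i * zbar t i) - y t) ^ 2
        ≤ (1 / 2) * ∑ t ∈ Finset.Icc 1 T, (z t j - y t) ^ 2
          + lam / 2 + N * Y ^ 2 / 2 * Real.log (1 + Y ^ 2 * T / lam) := by
  intro j
  have hbound : ∀ t ∈ Finset.Icc 1 T, ∀ i, |zbar t i| ≤ Y := fun t _ i ↦ by
    rw [hzbar, abs_le]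
    exact ⟨le_min (by linarith) (le_max_right _ _), min_le_left _ _⟩
  have hregret := vaw_regret_bound hlam zbar y T hy hbound (Pi.single j 1)
  have hclip : ∑ t ∈ Finset.Icc 1 T, (zbar t j - y t) ^ 2
      ≤ ∑ t ∈ Finset.Icc 1 T, (z t j - y t) ^ 2 :=
    Finset.sum_le_sum fun t ht ↦ by
      rw [hzbar]
      exact sq_clip_sub_le (hy t ht)
  simp only [single_one_dotProduct, Pi.single_eq_same, Fintype.card_fin, mul_one] at hregret
  simp only [dotProduct] at hregret
  linarith
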